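/- Let A be a unital C*-algebra equipped with a unital *-homomorphism μ : C([0,1]) → Z(A) into its centre (a C([0,1])-algebra). For t ∈ [0,1], let J_t be the closed two-sided ideal generated by μ({f ∈ C([0,1]) : f(t) = 0})·A, and let π_t : A → A/J_t be the quotient map. Then for every a ∈ A, ‖a‖ = sup_{t ∈ [0,1]} ‖π_t(a)‖. -/

import Mathlib

open Filter Topology

section CentralAction

variable {X A : Type*} [TopologicalSpace X] [CompactSpace X] [CStarAlgebra A]
  (μ : C(X, ℂ) →⋆ₐ[ℂ] A)

/-- The span of the products `μ f * a` with `f t = 0`, whose closure is the ideal at `t`. -/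
noncomputable def vanishingSpan (t : X) : Submodule ℂ A :=
  Submodule.span ℂ {x : A | ∃ (f : C(X, ℂ)) (a : A), f t = 0 ∧ x = μ f * a}

lemma norm_map_mul_le {g : C(X, ℂ)} {r : ℝ} (hg : ‖g‖ ≤ r) (b : A) : ‖μ g * b‖ ≤ r * ‖b‖ :=
  (norm_mul_le _ _).trans <| by
    gcongr
    exact (NonUnitalStarAlgHom.norm_apply_le μ g).trans hg

/-- Elements of the ideal at `t` are small near `t`. -/
lemma eventually_norm_map_mul_le_of_mem_span {t : X} {j : A} (hj : j ∈ vanishingSpan μ t) :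
    ∀ ε > 0, ∀ᶠ U in (𝓝 t).smallSets, ∀ g : C(X, ℂ), ‖g‖ ≤ 1 → Function.support g ⊆ U →
      ‖μ g * j‖ ≤ ε := by
  induction hj using Submodule.span_induction with
  | mem x hx =>
    obtain ⟨f, a, hf, rfl⟩ := hx
    intro ε hε
    have hδ : 0 < ε / (‖a‖ + 1) := by positivity
    have hnear : ∀ᶠ s in 𝓝 t, ‖f s‖ < ε / (‖a‖ + 1) := by
      have : Tendsto (fun s => ‖f s‖) (𝓝 t) (𝓝 0) := by
        simpa [hf] using (f.continuous.norm.tendsto t)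
      exact this.eventually_lt_const hδ
    filter_upwards [eventually_smallSets_subset.2 hnear] with U hU g hg hgU
    have hgf : ‖g * f‖ ≤ ε / (‖a‖ + 1) := by
      refine (ContinuousMap.norm_le _ hδ.le).2 fun s => ?_
      by_cases hs : g s = 0
      · simpa [hs] using hδ.le
      · have h1 : ‖g s‖ ≤ 1 := (g.norm_coe_le_norm s).trans hg
        have h2 : ‖f s‖ < ε / (‖a‖ + 1) := hU (hgU hs)
        rw [ContinuousMap.mul_apply, norm_mul]
        nlinarith [norm_nonneg (f s)]
    calc ‖μ g * (μ f * a)‖ = ‖μ (g * f) * a‖ := by rw [map_mul, mul_assoc]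
      _ ≤ ε / (‖a‖ + 1) * ‖a‖ := norm_map_mul_le μ hgf a
      _ ≤ ε / (‖a‖ + 1) * (‖a‖ + 1) := by gcongr; linarith
      _ = ε := by field_simp
  | zero =>
    intro ε hε
    exact Eventually.of_forall fun U g _ _ => by simpa using hε.le
  | add x y _ _ hx hy =>
    intro ε hε
    filter_upwards [hx (ε / 2) (by positivity), hy (ε / 2) (by positivity)] with U h1 h2 g hg hgU
    rw [mul_add]
    exact (norm_add_le _ _).trans (by linarith [h1 g hg hgU, h2 g hg hgU])
  | smul c x _ hx =>
    intro ε hε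
    filter_upwards [hx (ε / (‖c‖ + 1)) (by positivity)] with U h g hg hgU
    rw [mul_smul_comm, norm_smul]
    calc ‖c‖ * ‖μ g * x‖ ≤ (‖c‖ + 1) * (ε / (‖c‖ + 1)) := by
          gcongr
          · linarith
          · exact h g hg hgU
      _ = ε := by field_simp

lemma exists_nhds_norm_map_mul_le {t : X} {a j : A} {C : ℝ}
    (hj : j ∈ closure (vanishingSpan μ t : Set A)) (hC : ‖a - j‖ < C) :
    ∃ U ∈ 𝓝 t, ∀ g : C(X, ℂ), ‖g‖ ≤ 1 → Function.support g ⊆ U → ‖μ g * a‖ ≤ C := by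
  obtain ⟨i, hi, hij⟩ := Metric.mem_closure_iff.1 hj (C - ‖a - j‖) (by linarith)
  rw [dist_eq_norm] at hij
  have hai : ‖a - i‖ < C := by linarith [norm_sub_le_norm_sub_add_norm_sub a j i]
  obtain ⟨U, hU, h⟩ := eventually_smallSets.1
    (eventually_norm_map_mul_le_of_mem_span μ hi (C - ‖a - i‖) (by linarith))
  refine ⟨U, hU, fun g hg hgU => ?_⟩
  have h1 := h U subset_rfl g hg hgU
  have h2 := norm_map_mul_le μ hg (a - i)
  calc ‖μ g * a‖ = ‖μ g * (a - i) + μ g * i‖ := by rw [← mul_add, sub_add_cancel]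
    _ ≤ C := (norm_add_le _ _).trans (by linarith)

/-- A real-valued continuous function, viewed as a complex-valued one. -/
def complexify (f : C(X, ℝ)) : C(X, ℂ) := ⟨fun x => (f x : ℂ), by fun_prop⟩

variable [T2Space X] [PartialOrder A] [StarOrderedRing A]

/-- If the cut-offs of `a` near `t` have norm at most `C`, then `a⋆a ≤ C²` near `t`. -/
lemma exists_isOpen_map_mul_nonneg (hcentral : ∀ (f : C(X, ℂ)) (a : A), μ f * a = a * μ f)
    {t : X} {a : A} {C : ℝ} (hC : 0 ≤ C)
    (h : ∃ U ∈ 𝓝 t, ∀ g : C(X, ℂ), ‖g‖ ≤ 1 → Function.support g ⊆ U → ‖μ g * a‖ ≤ C) :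
    ∃ V, IsOpen V ∧ t ∈ V ∧ ∀ φ : C(X, ℝ), 0 ≤ φ → Function.support φ ⊆ V →
      0 ≤ μ (complexify φ) * (algebraMap ℝ A (C ^ 2) - star a * a) := by
  obtain ⟨U, hU, h⟩ := h
  obtain ⟨K, hK, hKU, hKc⟩ := local_compact_nhds (isOpen_interior.mem_nhds
    (mem_interior_iff_mem_nhds.2 hU))
  obtain ⟨g, hgU, hgK, hg⟩ := exists_tsupport_one_of_isOpen_isClosed isOpen_interior
    isClosed_closure.isCompact hKc.isClosed hKU
  refine ⟨interior K, isOpen_interior, mem_interior_iff_mem_nhds.2 hK, fun φ hφ hφK => ?_⟩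
  set ρ : C(X, ℝ) := ⟨fun x => √(φ x), by fun_prop⟩ with hρ
  have hbound : ‖μ (complexify g) * a‖ ≤ C := by
    refine h _ ((ContinuousMap.norm_le _ zero_le_one).2 fun x => ?_) fun x hx => ?_
    · simpa [complexify, abs_of_nonneg (hg x).1] using (hg x).2
    · refine interior_subset (hgU (subset_tsupport _ ?_))
      simpa [complexify] using hx
  have hpos : 0 ≤ algebraMap ℝ A (C ^ 2) -
      star (μ (complexify g) * a) * (μ (complexify g) * a) := by
    refine sub_nonneg.2 (CStarAlgebra.star_mul_le_algebraMap_norm_sq.trans ?_)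
    exact algebraMap_mono A (by gcongr)
  have hsq : star (complexify ρ) * complexify ρ = complexify φ := by
    ext x
    simpa [complexify, hρ, ← Complex.ofReal_mul] using Real.mul_self_sqrt (hφ x)
  have hcut : complexify φ * (star (complexify g) * complexify g) = complexify φ := by
    ext x
    by_cases hx : φ x = 0
    · simp [complexify, hx]
    · have : g x = 1 := hgK (interior_subset (hφK hx))
      simp [complexify, this]
  convert star_left_conjugate_nonneg hpos (μ (complexify ρ)) using 1
  have hexp : star (μ (complexify g) * a) * (μ (complexify g) * a) =
      μ (star (complexify g) * complexify g) * (star a * a) := by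
    rw [star_mul, ← map_star, ← hcentral, map_mul, mul_assoc, mul_assoc, ← mul_assoc (star a),
      ← hcentral, mul_assoc]
  rw [mul_assoc, ← hcentral, ← mul_assoc, ← map_star, ← map_mul, hsq, hexp, mul_sub, mul_sub,
    ← mul_assoc (μ _) (μ _), ← map_mul, hcut]

end CentralAction

lemma norm_le_of_forall_exists_nhds {X A : Type*} [TopologicalSpace X] [CompactSpace X]
    [T2Space X] [CStarAlgebra A] (μ : C(X, ℂ) →⋆ₐ[ℂ] A)
    (hcentral : ∀ (f : C(X, ℂ)) (a : A), μ f * a = a * μ f) {a : A} {C : ℝ} (hC : 0 ≤ C)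
    (h : ∀ t, ∃ U ∈ 𝓝 t, ∀ g : C(X, ℂ), ‖g‖ ≤ 1 → Function.support g ⊆ U → ‖μ g * a‖ ≤ C) :
    ‖a‖ ≤ C := by
  let _ : PartialOrder A := CStarAlgebra.spectralOrder A
  have _ : StarOrderedRing A := CStarAlgebra.spectralOrderedRing A
  choose V hVo hV hpos using fun t => exists_isOpen_map_mul_nonneg μ hcentral hC (h t)
  obtain ⟨T, hT⟩ := isCompact_univ.elim_finite_subcover V hVo
    fun x _ => Set.mem_iUnion.2 ⟨x, hV x⟩
  obtain ⟨φ, hφV, hφ1, hφ, -⟩ := exists_continuous_sum_one_of_isOpen_isCompact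
    (s := fun i => V (T.equivFin.symm i)) (fun i => hVo _) isCompact_univ fun x hx => by
      obtain ⟨t, ht, hxt⟩ := Set.mem_iUnion₂.1 (hT hx)
      exact Set.mem_iUnion.2 ⟨T.equivFin ⟨t, ht⟩, by simpa using hxt⟩
  have hsum : ∑ i, complexify (φ i) = 1 := by
    ext x
    have := hφ1 (Set.mem_univ x)
    simp only [Finset.sum_apply, Pi.one_apply] at this
    simp [complexify, ← Complex.ofReal_sum, this]
  have hnonneg : 0 ≤ algebraMap ℝ A (C ^ 2) - star a * a := by
    rw [← one_mul (_ - _), ← map_one μ, ← hsum, map_sum, Finset.sum_mul]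
    exact Finset.sum_nonneg fun i _ => hpos _ _ (fun x => (hφ i x).1)
      ((subset_tsupport _).trans (hφV i))
  have hnorm := (CStarAlgebra.norm_le_iff_le_algebraMap (star a * a) (sq_nonneg C)
    (star_mul_self_nonneg a)).2 (sub_nonneg.1 hnonneg)
  rw [CStarRing.norm_star_mul_self, ← sq] at hnorm
  exact (sq_le_sq₀ (norm_nonneg a) hC).1 hnorm


open unitInterval

/-- If `A` is a unital C*-algebra which is a `C([0,1])`-algebra via a
unital *-homomorphism `μ : C([0,1]) → Z(A)` into the centre, then with
`J_t := closure (span { μ f * a : f t = 0 })` (a closed two-sided ideal) and the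
quotient norm `‖π_t a‖ = inf { ‖a - j‖ : j ∈ J_t }`, one has
`‖a‖ = ⨆ t ∈ [0,1], ‖π_t a‖`. -/
theorem stmt4 {A : Type*} [CStarAlgebra A]
    (μ : C(I, ℂ) →⋆ₐ[ℂ] A)
    (hcentral : ∀ (f : C(I, ℂ)) (a : A), μ f * a = a * μ f)
    (J : I → Set A)
    (hJ : ∀ t, J t = closure
      ((Submodule.span ℂ {x : A | ∃ (f : C(I, ℂ)) (a : A), f t = 0 ∧ x = μ f * a}) : Set A))
    (a : A) :
    ‖a‖ = ⨆ t : I, sInf ((fun j => ‖a - j‖) '' J t) := by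
  have hJ' : ∀ t, J t = closure (vanishingSpan μ t : Set A) := hJ
  have hzero : ∀ t, (0 : A) ∈ J t := fun t => hJ' t ▸ subset_closure (zero_mem _)
  have hbdd : ∀ t, BddBelow ((fun j => ‖a - j‖) '' J t) := fun t =>
    ⟨0, Set.forall_mem_image.2 fun j _ => norm_nonneg _⟩
  have hle : ∀ t, sInf ((fun j => ‖a - j‖) '' J t) ≤ ‖a‖ := fun t =>
    csInf_le (hbdd t) ⟨0, hzero t, by simp⟩
  refine le_antisymm (le_of_forall_gt_imp_ge_of_dense fun C hC => ?_) (ciSup_le hle)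
  have hlt : ∀ t, sInf ((fun j => ‖a - j‖) '' J t) < C := fun t =>
    (le_ciSup ⟨‖a‖, Set.forall_mem_range.2 hle⟩ t).trans_lt hC
  have hC0 : 0 ≤ C := (Real.sInf_nonneg (Set.forall_mem_image.2 fun j _ =>
    norm_nonneg _)).trans (hlt 0).le
  refine norm_le_of_forall_exists_nhds μ hcentral hC0 fun t => ?_
  obtain ⟨_, ⟨j, hj, rfl⟩, hjC⟩ := exists_lt_of_csInf_lt (Set.Nonempty.image _ ⟨0, hzero t⟩) (hlt t)
  exact exists_nhds_norm_map_mul_le μ (hJ' t ▸ hj) hjC
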